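/- Let C be an isotropic centrally symmetric convex body in ℝⁿ and K a centrally symmetric convex body in ℝⁿ. There are absolute constants c₁, c₂ > 0 such that for every s ≥ 1 and every t ∈ ℝˢ, (c₁ / C₂(X_K)) · vol_n(K)^{−1/n} · ‖t‖₂ ≤ ∫_C⋯∫_C ‖∑_{j=1}^s t_j x_j‖_K dx₁⋯dx_s ≤ c₂ L_C C₂(X_K) √n M(K) ‖t‖₂. -/

import Mathlib

open MeasureTheory Real
open scoped ENNReal RealInnerProductSpace

noncomputable section

/-- A centrally symmetric convex body. -/
def IsSymmConvexBody {n : ℕ} (C : Set (EuclideanSpace ℝ (Fin n))) : Prop :=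
  Convex ℝ C ∧ IsCompact C ∧ (interior C).Nonempty ∧ C = -C

/-- `C` is isotropic with isotropic constant `L`. -/
def IsIsotropic {n : ℕ} (C : Set (EuclideanSpace ℝ (Fin n))) (L : ℝ) : Prop :=
  volume C = 1 ∧ (∫ x in C, x) = 0 ∧ 0 < L ∧
    ∀ ξ : EuclideanSpace ℝ (Fin n), ‖ξ‖ = 1 → (∫ x in C, ⟪x, ξ⟫ ^ 2) = L ^ 2

/-- The cotype-2 inequality for the norm `‖·‖_K` with constant `Cst`:
`(𝔼_ε ‖∑ ε_i x_i‖_K²)^{1/2} ≥ (1/Cst) (∑ ‖x_i‖_K²)^{1/2}` for all finite families. -/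
def CotypeTwoIneq {n : ℕ} (K : Set (EuclideanSpace ℝ (Fin n))) (Cst : ℝ) : Prop :=
  ∀ (k : ℕ) (x : Fin k → EuclideanSpace ℝ (Fin n)),
    (1 / Cst) * Real.sqrt (∑ i, gauge K (x i) ^ 2)
      ≤ Real.sqrt ((2 ^ k : ℝ)⁻¹ *
          ∑ ε : Fin k → Bool, gauge K (∑ i, (if ε i then (1 : ℝ) else -1) • x i) ^ 2)

/-- `M(K) = ∫_{S^{n-1}} ‖ξ‖_K dσ(ξ)`. -/
def sphereM {n : ℕ} (K : Set (EuclideanSpace ℝ (Fin n))) : ℝ :=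
  ⨍ ξ, gauge K (ξ : EuclideanSpace ℝ (Fin n))
    ∂((volume : Measure (EuclideanSpace ℝ (Fin n))).toSphere)

/-- The Euclidean norm of `t ∈ ℝˢ`. -/
def euclNorm {s : ℕ} (t : Fin s → ℝ) : ℝ := Real.sqrt (∑ j, t j ^ 2)

/-! ### The Khinchine–Kahane inequality on the discrete cube -/

theorem sum_boolCube_succ {k : ℕ} (F : (Fin (k + 1) → Bool) → ℝ) :
    ∑ ε, F ε = ∑ ε : Fin k → Bool, (F (Fin.cons true ε) + F (Fin.cons false ε)) := by
  rw [← (Fin.consEquiv fun _ => Bool).sum_comp, Fintype.sum_prod_type]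
  simp [Finset.sum_add_distrib, Fin.consEquiv]

/-- The Dirichlet energy of a function on the discrete cube, up to normalization. -/
def cubeEnergy {k : ℕ} (f : (Fin k → Bool) → ℝ) : ℝ :=
  ∑ ε, ∑ i, f ε * (f ε - f (Function.update ε i (!ε i)))

/-- Splitting off the first coordinate, in terms of half-sum `g` and half-difference `h`. -/
theorem cubeEnergy_succ {k : ℕ} (f : (Fin (k + 1) → Bool) → ℝ) (g h : (Fin k → Bool) → ℝ)
    (hg : ∀ ε, g ε = (f (Fin.cons true ε) + f (Fin.cons false ε)) / 2)
    (hh : ∀ ε, h ε = (f (Fin.cons true ε) - f (Fin.cons false ε)) / 2) :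
    cubeEnergy f = 2 * cubeEnergy g + 2 * cubeEnergy h + 4 * ∑ ε, h ε ^ 2 := by
  unfold cubeEnergy
  rw [sum_boolCube_succ]
  simp only [Fin.sum_univ_succ, Fin.cons_zero, Fin.update_cons_zero, Fin.cons_succ,
    ← Fin.cons_update, Finset.mul_sum, ← Finset.sum_add_distrib]
  refine Finset.sum_congr rfl fun ε _ => ?_
  rw [add_add_add_comm, ← Finset.sum_add_distrib, add_comm]
  congr 1
  · refine Finset.sum_congr rfl fun i _ => ?_
    simp only [hg, hh]
    ring
  · simp only [hh, Bool.not_true, Bool.not_false]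
    ring

theorem sum_sq_boolCube_succ {k : ℕ} (f : (Fin (k + 1) → Bool) → ℝ) (g h : (Fin k → Bool) → ℝ)
    (hg : ∀ ε, g ε = (f (Fin.cons true ε) + f (Fin.cons false ε)) / 2)
    (hh : ∀ ε, h ε = (f (Fin.cons true ε) - f (Fin.cons false ε)) / 2) :
    ∑ ε, f ε ^ 2 = 2 * ∑ ε, g ε ^ 2 + 2 * ∑ ε, h ε ^ 2 := by
  rw [sum_boolCube_succ]
  simp only [Finset.mul_sum, ← Finset.sum_add_distrib]
  refine Finset.sum_congr rfl fun ε _ => ?_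
  rw [hg, hh]
  ring

/-- Poincaré inequality on the discrete cube. -/
theorem poincare_boolCube {k : ℕ} (f : (Fin k → Bool) → ℝ) :
    2 * (∑ ε, f ε ^ 2 - (∑ ε, f ε) ^ 2 / 2 ^ k) ≤ cubeEnergy f := by
  induction k with
  | zero => simp [cubeEnergy]
  | succ k ih =>
    let g : (Fin k → Bool) → ℝ := fun ε => (f (Fin.cons true ε) + f (Fin.cons false ε)) / 2
    let h : (Fin k → Bool) → ℝ := fun ε => (f (Fin.cons true ε) - f (Fin.cons false ε)) / 2
    have hsum : ∑ ε, f ε = 2 * ∑ ε, g ε := by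
      rw [sum_boolCube_succ, Finset.mul_sum]
      exact Finset.sum_congr rfl fun ε _ => by simp only [g]; ring
    rw [cubeEnergy_succ f g h (fun _ => rfl) fun _ => rfl,
      sum_sq_boolCube_succ f g h (fun _ => rfl) fun _ => rfl, hsum]
    have h1 := ih g
    have h2 : 0 ≤ cubeEnergy h := by
      refine le_trans ?_ (ih h)
      have hcs := sq_sum_le_card_mul_sum_sq (s := Finset.univ) (f := h)
      simp only [Finset.card_univ, Fintype.card_pi, Fintype.card_bool, Finset.prod_const,
        Fintype.card_fin] at hcs
      push_cast at hcs
      have : (∑ ε, h ε) ^ 2 / 2 ^ k ≤ ∑ ε, h ε ^ 2 := by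
        rw [div_le_iff₀ (by positivity)]
        linarith
      linarith
    have h3 : (2 * ∑ ε, g ε) ^ 2 / 2 ^ (k + 1) = 2 * ((∑ ε, g ε) ^ 2 / 2 ^ k) := by
      rw [pow_succ]
      field_simp
      ring
    rw [h3]
    linarith

/-- Improved Poincaré inequality on the discrete cube: the spectral gap doubles on functions
orthogonal to the coordinates. -/
theorem poincare_boolCube_second {k : ℕ} (f : (Fin k → Bool) → ℝ) :
    4 * (∑ ε, f ε ^ 2 - (∑ ε, f ε) ^ 2 / 2 ^ k)
      - 2 * ∑ i, (∑ ε : Fin k → Bool, (if ε i then (1 : ℝ) else -1) * f ε) ^ 2 / 2 ^ k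
      ≤ cubeEnergy f := by
  induction k with
  | zero => simp [cubeEnergy]
  | succ k ih =>
    let g : (Fin k → Bool) → ℝ := fun ε => (f (Fin.cons true ε) + f (Fin.cons false ε)) / 2
    let h : (Fin k → Bool) → ℝ := fun ε => (f (Fin.cons true ε) - f (Fin.cons false ε)) / 2
    have hsum : ∑ ε, f ε = 2 * ∑ ε, g ε := by
      rw [sum_boolCube_succ, Finset.mul_sum]
      exact Finset.sum_congr rfl fun ε _ => by simp only [g]; ring
    have hzero : ∑ ε : Fin (k + 1) → Bool, (if ε 0 then (1 : ℝ) else -1) * f ε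
        = 2 * ∑ ε, h ε := by
      rw [sum_boolCube_succ, Finset.mul_sum]
      exact Finset.sum_congr rfl fun ε _ => by simp [h]; ring
    have hsucc (i : Fin k) :
        ∑ ε : Fin (k + 1) → Bool, (if ε i.succ then (1 : ℝ) else -1) * f ε
          = 2 * ∑ ε : Fin k → Bool, (if ε i then (1 : ℝ) else -1) * g ε := by
      rw [sum_boolCube_succ, Finset.mul_sum]
      exact Finset.sum_congr rfl fun ε _ => by simp only [Fin.cons_succ, g]; ring
    rw [cubeEnergy_succ f g h (fun _ => rfl) fun _ => rfl,
      sum_sq_boolCube_succ f g h (fun _ => rfl) fun _ => rfl, hsum, Fin.sum_univ_succ, hzero]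
    simp only [hsucc]
    have h1 := ih g
    have h2 := poincare_boolCube h
    have h3 (x : ℝ) : (2 * x) ^ 2 / 2 ^ (k + 1) = 2 * (x ^ 2 / 2 ^ k) := by
      rw [pow_succ]
      field_simp
      ring
    simp only [h3, ← Finset.mul_sum]
    linarith

section Kahane

variable {E : Type*} [AddCommGroup E] [Module ℝ E]

theorem sum_signs_update {k : ℕ} (x : Fin k → E) (ε : Fin k → Bool) (i : Fin k) :
    ∑ j, (if Function.update ε i (!ε i) j then (1 : ℝ) else -1) • x j
      = ∑ j, (if ε j then (1 : ℝ) else -1) • x j - (2 : ℝ) • (if ε i then (1 : ℝ) else -1) • x i := by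
  rw [eq_sub_iff_add_eq, ← Finset.add_sum_erase _ _ (Finset.mem_univ i),
    ← Finset.add_sum_erase _ (fun j => (if ε j then (1 : ℝ) else -1) • x j) (Finset.mem_univ i)]
  have : ∑ j ∈ Finset.univ.erase i, (if Function.update ε i (!ε i) j then (1 : ℝ) else -1) • x j
      = ∑ j ∈ Finset.univ.erase i, (if ε j then (1 : ℝ) else -1) • x j :=
    Finset.sum_congr rfl fun j hj => by
      rw [Function.update_of_ne (Finset.ne_of_mem_erase hj)]
  rw [this, Function.update_self]
  cases ε i <;> simp <;> module

/-- The Khinchine–Kahane inequality between first and second moments, with the optimal constant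
of Latała and Oleszkiewicz. -/
theorem kahane_sq_le (p : Seminorm ℝ E) {k : ℕ} (x : Fin k → E) :
    (2 ^ k : ℝ)⁻¹ * ∑ ε : Fin k → Bool, p (∑ i, (if ε i then (1 : ℝ) else -1) • x i) ^ 2
      ≤ 2 * ((2 ^ k : ℝ)⁻¹ *
        ∑ ε : Fin k → Bool, p (∑ i, (if ε i then (1 : ℝ) else -1) • x i)) ^ 2 := by
  set f : (Fin k → Bool) → ℝ := fun ε => p (∑ i, (if ε i then (1 : ℝ) else -1) • x i) with hf
  have heven (i : Fin k) : ∑ ε : Fin k → Bool, (if ε i then (1 : ℝ) else -1) * f ε = 0 := by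
    let e : (Fin k → Bool) ≃ (Fin k → Bool) := Equiv.piCongrRight fun _ => Equiv.boolNot
    have hodd : ∀ ε, (if e ε i then (1 : ℝ) else -1) * f (e ε)
        = -((if ε i then (1 : ℝ) else -1) * f ε) := by
      intro ε
      have hs (j : Fin k) : (if e ε j then (1 : ℝ) else -1) = -(if ε j then (1 : ℝ) else -1) := by
        simp only [e, Equiv.piCongrRight_apply, Pi.map_apply, Equiv.boolNot_apply]
        cases ε j <;> simp
      simp only [hf, hs, neg_smul, Finset.sum_neg_distrib, map_neg_eq_map, neg_mul]
    have := e.sum_comp fun ε => (if ε i then (1 : ℝ) else -1) * f ε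
    simp only [hodd, Finset.sum_neg_distrib] at this
    linarith
  have hupper : cubeEnergy f ≤ 2 * ∑ ε, f ε ^ 2 := by
    rw [cubeEnergy, Finset.mul_sum]
    refine Finset.sum_le_sum fun ε _ => ?_
    rw [← Finset.mul_sum, Finset.sum_sub_distrib]
    have h0 : 0 ≤ f ε := apply_nonneg p _
    have key : ((k : ℝ) - 2) * f ε ≤ ∑ i, f (Function.update ε i (!ε i)) := by
      calc ((k : ℝ) - 2) * f ε ≤ ‖(k : ℝ) - 2‖ * f ε := by
            gcongr
            exact le_abs_self _
        _ = p (((k : ℝ) - 2) • ∑ i, (if ε i then (1 : ℝ) else -1) • x i) := by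
            rw [map_smul_eq_mul]
        _ = p (∑ i, ∑ j, (if Function.update ε i (!ε i) j then (1 : ℝ) else -1) • x j) := by
            simp only [sum_signs_update, Finset.sum_sub_distrib, Finset.sum_const,
              Finset.card_univ, Fintype.card_fin, ← Finset.smul_sum]
            rw [sub_smul, Nat.cast_smul_eq_nsmul]
        _ ≤ ∑ i, f (Function.update ε i (!ε i)) := by
            exact Finset.le_sum_of_subadditive p (map_zero p).le (map_add_le_add p) _ _
    simp only [Finset.sum_const, Finset.card_univ, Fintype.card_fin, nsmul_eq_mul]
    nlinarith
  have hlower := poincare_boolCube_second f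
  simp only [heven] at hlower
  have hk : (0 : ℝ) < 2 ^ k := by positivity
  have h : ∑ ε, f ε ^ 2 ≤ 2 * ((∑ ε, f ε) ^ 2 / 2 ^ k) := by
    simp at hlower
    linarith
  calc (2 ^ k : ℝ)⁻¹ * ∑ ε, f ε ^ 2 ≤ (2 ^ k : ℝ)⁻¹ * (2 * ((∑ ε, f ε) ^ 2 / 2 ^ k)) := by gcongr
    _ = _ := by ring

end Kahane

/-! ### Finite quadrature formulas -/

/-- In finite dimension, the convex hull of a compact set is compact. -/
theorem isCompact_convexHull_of_finiteDimensional {V : Type*} [NormedAddCommGroup V]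
    [NormedSpace ℝ V] [FiniteDimensional ℝ V] {s : Set V} (hs : IsCompact s) :
    IsCompact (convexHull ℝ s) := by
  let F (k : ℕ) : Set V := (fun q : (Fin k → ℝ) × (Fin k → V) => ∑ i, q.1 i • q.2 i) ''
    (stdSimplex ℝ (Fin k) ×ˢ Set.univ.pi fun _ => s)
  have hF (k : ℕ) : IsCompact (F k) :=
    ((isCompact_stdSimplex ℝ (Fin k)).prod (isCompact_univ_pi fun _ => hs)).image (by fun_prop)
  have heq : convexHull ℝ s = ⋃ k ∈ Set.Iic (Module.finrank ℝ V + 1), F k := by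
    ext x
    simp only [Set.mem_iUnion, exists_prop]
    constructor
    · intro hx
      obtain ⟨ι, _, z, w, hz, haff, hw, hw1, rfl⟩ := eq_pos_convex_span_of_mem_convexHull hx
      have hcard : Fintype.card ι ≤ Module.finrank ℝ V + 1 :=
        haff.card_le_finrank_succ.trans (by gcongr; exact Submodule.finrank_le _)
      let e := (Fintype.equivFin ι).symm
      refine ⟨Fintype.card ι, hcard, (w ∘ e, z ∘ e), ⟨⟨fun i => (hw _).le, ?_⟩, ?_⟩, ?_⟩
      · exact (e.sum_comp w).trans hw1
      · exact fun i _ => hz (Set.mem_range_self _)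
      · exact e.sum_comp fun i => w i • z i
    · rintro ⟨k, -, ⟨w, z⟩, ⟨hw, hz⟩, rfl⟩
      exact mem_convexHull_of_exists_fintype w z hw.1 hw.2 (fun i => hz i trivial) rfl
  rw [heq]
  exact (Set.finite_Iic _).isCompact_biUnion fun k _ => hF k

/-- A finite-dimensional vector-valued continuous integral over a compact set is a finite convex
combination of values of the integrand. -/
theorem exists_sum_smul_eq_integral {X V : Type*} [TopologicalSpace X] [MeasurableSpace X]
    [NormedAddCommGroup V] [NormedSpace ℝ V] [FiniteDimensional ℝ V]
    {μ : Measure X} [IsProbabilityMeasure μ] {A : Set X} (hA : IsCompact A)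
    (hμ : ∀ᵐ x ∂μ, x ∈ A) {Φ : X → V} (hΦ : Continuous Φ) (hint : Integrable Φ μ) :
    ∃ (N : ℕ) (w : Fin N → ℝ) (x : Fin N → X),
      (∀ i, 0 ≤ w i) ∧ ∑ i, w i = 1 ∧ ∑ i, w i • Φ (x i) = ∫ x, Φ x ∂μ := by
  have hcpt := isCompact_convexHull_of_finiteDimensional (hA.image hΦ)
  have hmem := (convex_convexHull ℝ (Φ '' A)).integral_mem hcpt.isClosed
    (hμ.mono fun x hx => subset_convexHull ℝ _ (Set.mem_image_of_mem Φ hx)) hint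
  obtain ⟨ι, _, w, z, hw, hw1, hz, hsum⟩ := mem_convexHull_iff_exists_fintype.1 hmem
  choose x _ hx using hz
  let e := (Fintype.equivFin ι).symm
  refine ⟨Fintype.card ι, w ∘ e, x ∘ e, fun i => hw _, (e.sum_comp w).trans hw1, ?_⟩
  rw [← hsum, ← e.sum_comp]
  simp [hx]

/-! ### Sums of independent symmetric random vectors -/

/-- If the norm `p` has cotype 2 then independent symmetric random vectors satisfy a lower
estimate for the first moment of the norm of their sum. -/
theorem sqrt_sum_sq_integral_le {E F : Type*} [NormedAddCommGroup E] [NormedSpace ℝ E]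
    [NormedAddCommGroup F] [NormedSpace ℝ F] [MeasurableSpace F] [BorelSpace F]
    [SecondCountableTopology F] (p : Seminorm ℝ E) (hp : Continuous p) {k : ℕ} {D : ℝ}
    (hcot : ∀ x : Fin k → E, √(∑ i, p (x i) ^ 2)
      ≤ D * ((2 ^ k : ℝ)⁻¹ * ∑ ε : Fin k → Bool, p (∑ i, (if ε i then (1 : ℝ) else -1) • x i)))
    (μ : Measure F) [IsProbabilityMeasure μ] (hμ : MeasurePreserving (fun v : F => -v) μ μ)
    (T : Fin k → F →L[ℝ] E) (hT : ∀ i, Integrable (fun v => p (T i v)) μ) :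
    √(∑ i, (∫ v, p (T i v) ∂μ) ^ 2)
      ≤ D * ∫ x, p (∑ i, T i (x i)) ∂Measure.pi fun _ : Fin k => μ := by
  set P := Measure.pi fun _ : Fin k => μ
  have hTi (i : Fin k) : Integrable (fun x : Fin k → F => p (T i (x i))) P :=
    integrable_comp_eval (μ := fun _ => μ) (hT i)
  have hint (ε : Fin k → Bool) :
      Integrable (fun x : Fin k → F => p (∑ i, (if ε i then (1 : ℝ) else -1) • T i (x i))) P := by
    refine (integrable_finsetSum Finset.univ fun i _ => hTi i).mono'
      (Continuous.aestronglyMeasurable (by fun_prop)) (.of_forall fun x => ?_)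
    rw [Real.norm_of_nonneg (apply_nonneg p _)]
    refine (Finset.le_sum_of_subadditive p (map_zero p).le (map_add_le_add p) _ _).trans
      (Finset.sum_le_sum fun i _ => ?_)
    rw [map_smul_eq_mul]
    split_ifs <;> simp
  have hsymm (ε : Fin k → Bool) :
      ∫ x, p (∑ i, (if ε i then (1 : ℝ) else -1) • T i (x i)) ∂P
        = ∫ x, p (∑ i, T i (x i)) ∂P := by
    have hmp : MeasurePreserving
        (fun (x : Fin k → F) i => (if ε i then (1 : ℝ) else -1) • x i) P P := by
      refine measurePreserving_pi (fun _ => μ) (fun _ => μ)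
        (f := fun i v => (if ε i then (1 : ℝ) else -1) • v) fun i => ?_
      cases ε i
      · simpa using hμ
      · simpa using! MeasurePreserving.id μ
    have hemb : AEStronglyMeasurable (fun x : Fin k → F => p (∑ i, T i (x i)))
        (P.map fun x i => (if ε i then (1 : ℝ) else -1) • x i) :=
      Continuous.aestronglyMeasurable (by fun_prop)
    have := integral_map hmp.measurable.aemeasurable hemb
    rw [hmp.map_eq] at this
    rw [this]
    simp only [map_smul]
  have havg : ∫ x, (2 ^ k : ℝ)⁻¹ *
        ∑ ε : Fin k → Bool, p (∑ i, (if ε i then (1 : ℝ) else -1) • T i (x i)) ∂P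
      = ∫ x, p (∑ i, T i (x i)) ∂P := by
    rw [integral_const_mul, integral_finsetSum _ fun ε _ => hint ε]
    simp only [hsymm]
    simp
  set m : Fin k → ℝ := fun i => ∫ v, p (T i v) ∂μ with hm
  set B := √(∑ i, m i ^ 2) with hB
  rcases (Real.sqrt_nonneg (∑ i, m i ^ 2)).eq_or_lt' with h0 | hpos
  · rw [hB, h0, ← havg, ← integral_const_mul]
    exact integral_nonneg fun x => (Real.sqrt_nonneg _).trans (hcot fun i => T i (x i))
  · rw [← hB] at hpos
    have hBsq : B * B = ∑ i, m i ^ 2 := Real.mul_self_sqrt (by positivity)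
    have hmain : B * B ≤ B * (D * ∫ x, p (∑ i, T i (x i)) ∂P) := by
      calc B * B = ∫ x, ∑ i, m i * p (T i (x i)) ∂P := by
            rw [hBsq, integral_finsetSum _ fun i _ => (hTi i).const_mul _]
            refine Finset.sum_congr rfl fun i _ => ?_
            rw [integral_const_mul, sq]
            congr 1
            exact (integral_comp_eval (μ := fun _ => μ) (hT i).aestronglyMeasurable).symm
        _ ≤ ∫ x, B * (D * ((2 ^ k : ℝ)⁻¹ *
              ∑ ε : Fin k → Bool, p (∑ i, (if ε i then (1 : ℝ) else -1) • T i (x i)))) ∂P := by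
            refine integral_mono (integrable_finsetSum _ fun i _ => (hTi i).const_mul _)
              ((((integrable_finsetSum _ fun ε _ => hint ε).const_mul _).const_mul _).const_mul _)
              fun x => ?_
            refine (Real.sum_mul_le_sqrt_mul_sqrt _ _ _).trans ?_
            gcongr
            exact hcot fun i => T i (x i)
        _ = _ := by rw [integral_const_mul, integral_const_mul, havg]
    exact le_of_mul_le_mul_left hmain hpos

/-! ### Gaussian averages -/

/-- A Gaussian combination of vectors forming a tight frame is a multiple of a standard Gaussian
vector. -/
theorem map_sum_smul_pi_gaussianReal {E : Type*} [NormedAddCommGroup E] [InnerProductSpace ℝ E]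
    [FiniteDimensional ℝ E] [MeasurableSpace E] [BorelSpace E] {N : ℕ} (y : Fin N → E) (b : ℝ)
    (hy : ∀ ξ, ∑ i, ⟪y i, ξ⟫ ^ 2 = b ^ 2 * ‖ξ‖ ^ 2) :
    (Measure.pi fun _ : Fin N => ProbabilityTheory.gaussianReal 0 1).map (fun g => ∑ i, g i • y i)
      = (ProbabilityTheory.stdGaussian E).map (b • ·) := by
  have : IsProbabilityMeasure ((Measure.pi fun _ : Fin N =>
      ProbabilityTheory.gaussianReal 0 1).map (fun g => ∑ i, g i • y i)) :=
    Measure.isProbabilityMeasure_map (Continuous.aemeasurable (by fun_prop))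
  have : IsProbabilityMeasure ((ProbabilityTheory.stdGaussian E).map (b • ·)) :=
    Measure.isProbabilityMeasure_map (Continuous.aemeasurable (by fun_prop))
  refine Measure.ext_of_charFun (funext fun ξ => ?_)
  rw [charFun_map_smul, ProbabilityTheory.charFun_stdGaussian, charFun_apply,
    integral_map (Continuous.aemeasurable (by fun_prop))
      (Continuous.aestronglyMeasurable (by fun_prop))]
  simp_rw [sum_inner, Complex.ofReal_sum, Finset.sum_mul, Complex.exp_sum,
    integral_fintype_prod_eq_prod (f := fun i (x : ℝ) => Complex.exp (⟪x • y i, ξ⟫ * Complex.I)),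
    real_inner_smul_left, mul_comm _ (⟪_, _⟫), Complex.ofReal_mul, ← charFun_apply_real,
    ProbabilityTheory.charFun_gaussianReal]
  rw [← Complex.exp_sum]
  have h : ∑ i, (⟪y i, ξ⟫ : ℂ) ^ 2 = ((‖b‖ * ‖ξ‖ : ℝ) : ℂ) ^ 2 := by
    rw [← Complex.ofReal_pow, mul_pow, Real.norm_eq_abs, sq_abs, ← hy]
    push_cast
    rfl
  rw [norm_smul, ← h]
  simp [Finset.sum_div, Finset.sum_neg_distrib, neg_div]

/-- The standard Gaussian measure has the usual density. -/
theorem stdGaussian_eq_withDensity (E : Type*) [NormedAddCommGroup E] [InnerProductSpace ℝ E]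
    [FiniteDimensional ℝ E] [MeasurableSpace E] [BorelSpace E] :
    ProbabilityTheory.stdGaussian E = (volume : Measure E).withDensity fun x =>
      ENNReal.ofReal ((2 * π) ^ (-(Module.finrank ℝ E / 2 : ℝ)) * rexp (-(1 / 2) * ‖x‖ ^ 2)) := by
  set c : ℝ := (2 * π) ^ (-(Module.finrank ℝ E / 2 : ℝ)) with hc
  have hc0 : 0 < c := by positivity
  have hmeas : Measurable fun x : E => ENNReal.ofReal (c * rexp (-(1 / 2) * ‖x‖ ^ 2)) := by
    fun_prop
  have hmass : ∫ x : E, c * rexp (-(1 / 2) * ‖x‖ ^ 2) = 1 := by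
    rw [integral_const_mul]
    have h := GaussianFourier.integral_rexp_neg_mul_sq_norm (V := E) (b := 1 / 2) (by norm_num)
    rw [h, hc, show π / (1 / 2) = 2 * π by ring, ← Real.rpow_add (by positivity)]
    simp
  have hint : Integrable fun x : E => c * rexp (-(1 / 2) * ‖x‖ ^ 2) :=
    .of_integral_ne_zero (by rw [hmass]; exact one_ne_zero)
  have : IsFiniteMeasure ((volume : Measure E).withDensity fun x =>
      ENNReal.ofReal (c * rexp (-(1 / 2) * ‖x‖ ^ 2))) :=
    isFiniteMeasure_withDensity_ofReal hint.2
  refine Measure.ext_of_charFun (funext fun ξ => ?_)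
  rw [ProbabilityTheory.charFun_stdGaussian, charFun_apply,
    integral_withDensity_eq_integral_toReal_smul hmeas (by simp)]
  have hpt (x : E) : (ENNReal.ofReal (c * rexp (-(1 / 2) * ‖x‖ ^ 2))).toReal
        • Complex.exp (⟪x, ξ⟫ * Complex.I)
      = c * Complex.exp (-(1 / 2 : ℂ) * ‖x‖ ^ 2 + Complex.I * ⟪ξ, x⟫) := by
    rw [ENNReal.toReal_ofReal (by positivity), Complex.exp_add, Complex.real_smul,
      real_inner_comm]
    push_cast
    ring_nf
  simp_rw [hpt]
  rw [integral_const_mul, GaussianFourier.integral_cexp_neg_mul_sq_norm_add (by norm_num)]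
  have hpi : ((π : ℂ) / (1 / 2)) ^ (Module.finrank ℝ E / 2 : ℂ)
      = (((2 * π) ^ (Module.finrank ℝ E / 2 : ℝ) : ℝ) : ℂ) := by
    rw [Complex.ofReal_cpow (by positivity)]
    push_cast
    ring_nf
  rw [hpi, ← mul_assoc, ← Complex.ofReal_mul, hc, ← Real.rpow_add (by positivity)]
  simp only [neg_add_cancel, Real.rpow_zero, Complex.ofReal_one, one_mul, Complex.I_sq]
  congr 1
  ring

/-- Polar integration of the product of a radial function and a positively homogeneous one. -/
theorem integral_norm_mul_homogeneous {E : Type*} [NormedAddCommGroup E] [NormedSpace ℝ E]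
    [FiniteDimensional ℝ E] [Nontrivial E] [MeasurableSpace E] [BorelSpace E] (μ : Measure E)
    [μ.IsAddHaarMeasure] (φ : ℝ → ℝ) (q : E → ℝ) (hq : ∀ r : ℝ, 0 < r → ∀ x, q (r • x) = r * q x) :
    ∫ x, φ ‖x‖ * q x ∂μ = (∫ ξ, q (ξ : E) ∂μ.toSphere) *
      ∫ r : Set.Ioi (0 : ℝ), φ r * r ∂Measure.volumeIoiPow (Module.finrank ℝ E - 1) := by
  calc ∫ x, φ ‖x‖ * q x ∂μ = ∫ x : ({(0)}ᶜ : Set E), φ ‖x.1‖ * q x.1 ∂(μ.comap (↑)) := by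
        rw [integral_subtype_comap (measurableSet_singleton _).compl fun x => φ ‖x‖ * q x,
          restrict_compl_singleton]
    _ = ∫ z, q (z.1 : E) * (φ z.2 * z.2)
          ∂μ.toSphere.prod (.volumeIoiPow (Module.finrank ℝ E - 1)) := by
        rw [← μ.measurePreserving_homeomorphUnitSphereProd.integral_comp
          (Homeomorph.measurableEmbedding _)]
        refine integral_congr_ae (.of_forall fun x => ?_)
        have hx : 0 < ‖(x : E)‖ := norm_pos_iff.2 x.2
        have h := hq ‖(x : E)‖ hx (‖(x : E)‖⁻¹ • (x : E))
        rw [smul_inv_smul₀ hx.ne'] at h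
        simp only [homeomorphUnitSphereProd_apply_fst_coe, homeomorphUnitSphereProd_apply_snd_coe]
        rw [h]
        ring
    _ = _ := integral_prod_mul (fun ξ : Metric.sphere (0 : E) 1 => q ξ)
        fun r : Set.Ioi (0 : ℝ) => φ r * r

/-- The Gaussian average of a homogeneous function is its spherical average times the average
Gaussian norm. -/
theorem integral_stdGaussian_eq_average_mul {E : Type*} [NormedAddCommGroup E]
    [InnerProductSpace ℝ E] [FiniteDimensional ℝ E] [Nontrivial E] [MeasurableSpace E]
    [BorelSpace E] (q : E → ℝ) (hq : ∀ r : ℝ, 0 < r → ∀ x, q (r • x) = r * q x) :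
    ∫ x, q x ∂ProbabilityTheory.stdGaussian E
      = (⨍ ξ, q (ξ : E) ∂(volume : Measure E).toSphere)
        * ∫ x, ‖x‖ ∂ProbabilityTheory.stdGaussian E := by
  let φ : ℝ → ℝ := fun r => (2 * π) ^ (-(Module.finrank ℝ E / 2 : ℝ)) * rexp (-(1 / 2) * r ^ 2)
  have key (f : E → ℝ) : ∫ x, f x ∂ProbabilityTheory.stdGaussian E = ∫ x : E, φ ‖x‖ * f x := by
    rw [stdGaussian_eq_withDensity,
      integral_withDensity_eq_integral_toReal_smul (by fun_prop) (by simp)]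
    refine integral_congr_ae (.of_forall fun x => ?_)
    simp only [smul_eq_mul, φ]
    rw [ENNReal.toReal_ofReal (by positivity)]
  rw [key, key, integral_norm_mul_homogeneous _ φ q hq,
    integral_norm_mul_homogeneous _ φ (fun x => ‖x‖) fun r hr x => by
      rw [norm_smul, Real.norm_of_nonneg hr.le], average_eq]
  have h0 : (volume : Measure E).toSphere.real Set.univ ≠ 0 := by
    rw [measureReal_ne_zero_iff]
    exact Measure.measure_univ_ne_zero.2 (Measure.toSphere_ne_zero _)
  simp only [norm_eq_of_mem_sphere, integral_const, smul_eq_mul, mul_one]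
  field_simp

theorem integral_norm_stdGaussian_le (n : ℕ) :
    ∫ x, ‖x‖ ∂ProbabilityTheory.stdGaussian (EuclideanSpace ℝ (Fin n)) ≤ √n := by
  set γ := ProbabilityTheory.stdGaussian (EuclideanSpace ℝ (Fin n))
  have hmem : MemLp id 2 γ := ProbabilityTheory.IsGaussian.memLp_two_id
  have hsq : ∫ x, ‖x‖ ^ 2 ∂γ = n := by
    have hcoord (i : Fin n) : ∫ x, x i ^ 2 ∂γ = 1 := by
      have h := ProbabilityTheory.variance_dual_stdGaussian
        (EuclideanSpace.proj i : StrongDual ℝ (EuclideanSpace ℝ (Fin n)))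
      rw [ProbabilityTheory.variance_of_integral_eq_zero (by fun_prop)
        (ProbabilityTheory.integral_strongDual_stdGaussian _),
        (EuclideanSpace.basisFun (Fin n) ℝ).norm_dual] at h
      simpa using h
    simp_rw [EuclideanSpace.real_norm_sq_eq]
    rw [integral_finsetSum]
    · simp [hcoord]
    · intro i _
      exact (((EuclideanSpace.proj i : StrongDual ℝ (EuclideanSpace ℝ (Fin n))).comp_memLp'
        hmem).integrable_sq)
  have hvar := ProbabilityTheory.variance_nonneg (fun x => ‖x‖) γ
  have hnorm : MemLp (fun x => ‖x‖) 2 γ := hmem.norm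
  rw [ProbabilityTheory.variance_eq_sub hnorm] at hvar
  refine Real.le_sqrt_of_sq_le ?_
  have : ∫ x, ((fun x => ‖x‖) ^ 2) x ∂γ = n := hsq
  linarith

theorem integral_abs_gaussianReal_pos : 0 < ∫ x, |x| ∂ProbabilityTheory.gaussianReal 0 1 := by
  rw [integral_pos_iff_support_of_nonneg (fun x => abs_nonneg x)
    (ProbabilityTheory.IsGaussian.integrable_id.abs)]
  have : Function.support (fun x : ℝ => |x|) = {0}ᶜ := by
    ext x
    simp
  have := ProbabilityTheory.nullSingletonClass_gaussianReal (μ := 0) (v := 1) one_ne_zero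
  rw [‹Function.support _ = _›, prob_compl_eq_one_sub (measurableSet_singleton _), measure_singleton]
  simp

/-! ### Convex bodies -/

theorem IsSymmConvexBody.mem_nhds_zero {n : ℕ} {K : Set (EuclideanSpace ℝ (Fin n))}
    (hK : IsSymmConvexBody K) : K ∈ nhds 0 := by
  obtain ⟨hconv, -, ⟨x, hx⟩, hsymm⟩ := hK
  have hneg : -x ∈ interior K := by
    have hpre := (Homeomorph.neg (EuclideanSpace ℝ (Fin n))).preimage_interior K
    have hK : Homeomorph.neg (EuclideanSpace ℝ (Fin n)) ⁻¹' K = K := hsymm.symm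
    rw [hK] at hpre
    rw [← hpre] at hx
    exact hx
  have h0 := hconv.interior hx hneg (show (0 : ℝ) ≤ 1 / 2 by norm_num)
    (show (0 : ℝ) ≤ 1 / 2 by norm_num) (by norm_num)
  rw [smul_neg, add_neg_cancel] at h0
  exact mem_interior_iff_mem_nhds.1 h0

theorem IsSymmConvexBody.neg_mem {n : ℕ} {K : Set (EuclideanSpace ℝ (Fin n))}
    (hK : IsSymmConvexBody K) ⦃x : EuclideanSpace ℝ (Fin n)⦄ (hx : x ∈ K) : -x ∈ K := by
  rw [hK.2.2.2] at hx
  exact hx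

/-- The norm with unit ball a given symmetric convex body. -/
def IsSymmConvexBody.seminorm {n : ℕ} {K : Set (EuclideanSpace ℝ (Fin n))}
    (hK : IsSymmConvexBody K) : Seminorm ℝ (EuclideanSpace ℝ (Fin n)) :=
  gaugeSeminorm ((balanced_iff_neg_mem hK.1).2 hK.neg_mem) hK.1
    (absorbent_nhds_zero hK.mem_nhds_zero)

theorem IsSymmConvexBody.seminorm_apply {n : ℕ} {K : Set (EuclideanSpace ℝ (Fin n))}
    (hK : IsSymmConvexBody K) (x : EuclideanSpace ℝ (Fin n)) : hK.seminorm x = gauge K x :=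
  rfl

theorem IsSymmConvexBody.continuous_seminorm {n : ℕ} {K : Set (EuclideanSpace ℝ (Fin n))}
    (hK : IsSymmConvexBody K) : Continuous hK.seminorm :=
  continuous_gauge hK.1 hK.mem_nhds_zero

theorem CotypeTwoIneq.sqrt_sum_sq_le {n : ℕ} {K : Set (EuclideanSpace ℝ (Fin n))}
    (hK : IsSymmConvexBody K) {c : ℝ} (hc : 0 < c) (h : CotypeTwoIneq K c) {k : ℕ}
    (x : Fin k → EuclideanSpace ℝ (Fin n)) :
    √(∑ i, hK.seminorm (x i) ^ 2) ≤ √2 * c * ((2 ^ k : ℝ)⁻¹ *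
      ∑ ε : Fin k → Bool, hK.seminorm (∑ i, (if ε i then (1 : ℝ) else -1) • x i)) := by
  have h1 := h k x
  simp only [← hK.seminorm_apply] at h1
  have h2 := Real.sqrt_le_sqrt (kahane_sq_le hK.seminorm x)
  rw [Real.sqrt_mul zero_le_two, Real.sqrt_sq (mul_nonneg (by positivity)
    (Finset.sum_nonneg fun _ _ => apply_nonneg _ _))] at h2
  have h3 := h1.trans h2
  rw [one_div_mul_eq_div, div_le_iff₀ hc] at h3
  linarith

open scoped Pointwise in
/-- A body of volume one has average `K`-norm at least of the order of the inverse volume radius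
of `K`. -/
theorem quarter_volume_rpow_le_integral_gauge {n : ℕ} (hn : n ≠ 0)
    {C K : Set (EuclideanSpace ℝ (Fin n))} (hC : IsCompact C) (hvol : volume C = 1)
    (hK : IsSymmConvexBody K) :
    (1 / 4) * (volume K).toReal ^ (-(1 : ℝ) / n) ≤ ∫ x in C, hK.seminorm x := by
  set v := (volume K).toReal with hv
  have hv0 : 0 < v := ENNReal.toReal_pos
    (Measure.measure_pos_of_mem_nhds volume hK.mem_nhds_zero).ne' hK.2.1.measure_lt_top.ne
  set r := v ^ (-(1 : ℝ) / n) with hr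
  have hr0 : 0 < r := by positivity
  have hrn : r ^ n * v = 1 := by
    rw [hr, ← Real.rpow_natCast, ← Real.rpow_mul hv0.le,
      div_mul_cancel₀ _ (Nat.cast_ne_zero.2 hn), Real.rpow_neg_one, inv_mul_cancel₀ hv0.ne']
  have : IsProbabilityMeasure (volume.restrict C) := ⟨by simpa using hvol⟩
  have hsub : {x | r / 2 ≤ hK.seminorm x}ᶜ ⊆ (r / 2) • K := by
    intro x hx
    have hx : gauge K x < r / 2 := not_le.1 hx
    rw [Set.mem_smul_set_iff_inv_smul_mem₀ (by positivity)]
    refine setOfPred_gauge_lt_one_subset_self hK.1 (mem_of_mem_nhds hK.mem_nhds_zero)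
      (absorbent_nhds_zero hK.mem_nhds_zero) ?_
    change gauge K ((r / 2)⁻¹ • x) < 1
    rw [gauge_smul_of_nonneg (by positivity), smul_eq_mul, inv_mul_lt_one₀ (by positivity)]
    exact hx
  have hsmall : (volume.restrict C).real {x | r / 2 ≤ hK.seminorm x}ᶜ ≤ 1 / 2 := by
    have hscaled : volume.real ((r / 2) • K) = (1 / 2) ^ n := by
      rw [measureReal_def, Measure.addHaar_smul, ENNReal.toReal_mul,
        ENNReal.toReal_ofReal (abs_nonneg _), abs_of_pos (by positivity), ← hv,
        finrank_euclideanSpace_fin, div_pow, div_mul_eq_mul_div, hrn, one_div_pow]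
    calc (volume.restrict C).real {x | r / 2 ≤ hK.seminorm x}ᶜ
        ≤ (volume.restrict C).real ((r / 2) • K) := measureReal_mono hsub
      _ ≤ volume.real ((r / 2) • K) :=
        ENNReal.toReal_mono (hK.2.1.smul (r / 2)).measure_lt_top.ne
          (Measure.restrict_apply_le _ _)
      _ ≤ 1 / 2 := by
        rw [hscaled]
        exact pow_le_of_le_one (by norm_num) (by norm_num) hn
  have hmeas : MeasurableSet {x | r / 2 ≤ hK.seminorm x} :=
    (isClosed_le continuous_const hK.continuous_seminorm).measurableSet
  rw [probReal_compl_eq_one_sub hmeas] at hsmall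
  have hmarkov := mul_meas_ge_le_integral_of_nonneg (μ := volume.restrict C)
    (.of_forall fun x => apply_nonneg hK.seminorm x)
    (hK.continuous_seminorm.continuousOn.integrableOn_compact hC) (r / 2)
  have : r / 2 * (1 / 2) ≤ r / 2 * (volume.restrict C).real {x | r / 2 ≤ hK.seminorm x} := by
    gcongr
    linarith
  linarith

theorem IsSymmConvexBody.measurePreserving_neg {n : ℕ} {C : Set (EuclideanSpace ℝ (Fin n))}
    (hC : IsSymmConvexBody C) :
    MeasurePreserving (fun x : EuclideanSpace ℝ (Fin n) => -x)
      (volume.restrict C) (volume.restrict C) := by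
  have h := (Measure.measurePreserving_neg (volume : Measure (EuclideanSpace ℝ (Fin n))))
  have := h.restrict_preimage hC.2.1.measurableSet
  have hpre : Neg.neg ⁻¹' C = C := hC.2.2.2.symm
  rwa [hpre] at this

/-- The covariance of a weighted sum of independent isotropic vectors. -/
theorem IsIsotropic.integral_inner_sum_sq {n s : ℕ} {C : Set (EuclideanSpace ℝ (Fin n))}
    (hC : IsCompact C) {L : ℝ} (h : IsIsotropic C L) (t : Fin s → ℝ)
    (ξ : EuclideanSpace ℝ (Fin n)) :
    ∫ x, ⟪∑ j, t j • x j, ξ⟫ ^ 2 ∂Measure.pi (fun _ : Fin s => volume.restrict C)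
      = (L * euclNorm t) ^ 2 * ‖ξ‖ ^ 2 := by
  obtain ⟨hvol, hbary, -, hiso⟩ := h
  have : IsProbabilityMeasure (volume.restrict C) := ⟨by simpa using hvol⟩
  have hscale : ∫ x in C, ⟪x, ξ⟫ ^ 2 = L ^ 2 * ‖ξ‖ ^ 2 := by
    rcases eq_or_ne ξ 0 with rfl | hξ
    · simp
    · have h1 := hiso (‖ξ‖⁻¹ • ξ) (by rw [norm_smul, norm_inv, norm_norm,
        inv_mul_cancel₀ (norm_ne_zero_iff.2 hξ)])
      simp only [real_inner_smul_right, mul_pow] at h1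
      rw [integral_const_mul] at h1
      rw [← h1]
      field_simp
  have hmem (j : Fin s) : MemLp (fun x => t j * ⟪x, ξ⟫) 2 (volume.restrict C) := by
    have hcont : Continuous fun x : EuclideanSpace ℝ (Fin n) => t j * ⟪x, ξ⟫ := by fun_prop
    rw [memLp_two_iff_integrable_sq hcont.aestronglyMeasurable]
    exact (hcont.pow 2).continuousOn.integrableOn_compact hC
  have hmean (j : Fin s) : ∫ x in C, t j * ⟪x, ξ⟫ = 0 := by
    rw [integral_const_mul]
    have := integral_inner (𝕜 := ℝ) (μ := volume.restrict C) (f := fun x => x)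
      (continuous_id.continuousOn.integrableOn_compact hC) ξ
    simp only [hbary, inner_zero_right] at this
    simp only [real_inner_comm ξ, this, mul_zero]
  have hvar := ProbabilityTheory.variance_sum_pi (μ := fun _ => volume.restrict C) hmem
  rw [ProbabilityTheory.variance_of_integral_eq_zero] at hvar
  · have hlhs : ∀ x : Fin s → EuclideanSpace ℝ (Fin n),
        (∑ j, fun x : Fin s → EuclideanSpace ℝ (Fin n) => t j * ⟪x j, ξ⟫) x
          = ⟪∑ j, t j • x j, ξ⟫ := by
      intro x
      simp [sum_inner, real_inner_smul_left]
    simp only [hlhs] at hvar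
    rw [hvar, mul_pow, euclNorm, Real.sq_sqrt (by positivity)]
    rw [Finset.mul_sum, Finset.sum_mul]
    refine Finset.sum_congr rfl fun j _ => ?_
    rw [ProbabilityTheory.variance_of_integral_eq_zero
      (Continuous.aemeasurable (by fun_prop)) (hmean j)]
    simp only [mul_pow]
    rw [integral_const_mul, hscale]
    ring
  · exact Finset.aemeasurable_sum _ fun j _ => Continuous.aemeasurable (by fun_prop)
  · simp only [Finset.sum_apply]
    rw [integral_finsetSum]
    · refine Finset.sum_eq_zero fun j _ => ?_
      rw [← hmean j]
      exact integral_comp_eval (μ := fun _ => volume.restrict C)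
        (f := fun x => t j * ⟪x, ξ⟫) (hmem j).aestronglyMeasurable
    · exact fun j _ => integrable_comp_eval (μ := fun _ => volume.restrict C)
        (f := fun x => t j * ⟪x, ξ⟫) ((hmem j).integrable one_le_two)

/-- The dimension is positive as soon as there is an optimal cotype constant. -/
theorem CotypeTwoIneq.dim_ne_zero_of_isLeast {n : ℕ} {K : Set (EuclideanSpace ℝ (Fin n))} {c : ℝ}
    (hc : IsLeast {c : ℝ | 0 < c ∧ CotypeTwoIneq K c} c) : n ≠ 0 := by
  rintro rfl
  have hgauge (x : EuclideanSpace ℝ (Fin 0)) : gauge K x = 0 := by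
    rw [Subsingleton.elim x 0, gauge_zero]
  have h0 : 0 < c := hc.1.1
  have : c ≤ c / 2 := hc.2 ⟨half_pos h0, fun k x => by simp [hgauge]⟩
  linarith

theorem lower_bound_integral_gauge {n s : ℕ} {C K : Set (EuclideanSpace ℝ (Fin n))}
    (hn : n ≠ 0) (hC : IsSymmConvexBody C) (hvol : volume C = 1) (hK : IsSymmConvexBody K)
    {c : ℝ} (hc : 0 < c) (hcot : CotypeTwoIneq K c) (t : Fin s → ℝ) :
    1 / (4 * √2) / c * (volume K).toReal ^ (-(1 : ℝ) / n) * euclNorm t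
      ≤ ∫ x, hK.seminorm (∑ j, t j • x j) ∂Measure.pi (fun _ : Fin s => volume.restrict C) := by
  have : IsProbabilityMeasure (volume.restrict C) := ⟨by simpa using hvol⟩
  have h := sqrt_sum_sq_integral_le hK.seminorm hK.continuous_seminorm
    (k := s) (hcot.sqrt_sum_sq_le hK hc) (volume.restrict C) hC.measurePreserving_neg
    (fun j => t j • ContinuousLinearMap.id ℝ _) fun j =>
      (hK.continuous_seminorm.comp (by fun_prop)).continuousOn.integrableOn_compact hC.2.1
  set I := ∫ x in C, hK.seminorm x with hI
  have hI0 : 0 ≤ I := integral_nonneg fun x => apply_nonneg _ _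
  have hterm (j : Fin s) : ∫ v in C, hK.seminorm ((t j • ContinuousLinearMap.id ℝ
      (EuclideanSpace ℝ (Fin n))) v) = |t j| * I := by
    simp only [_root_.smul_apply, ContinuousLinearMap.id_apply, map_smul_eq_mul,
      Real.norm_eq_abs]
    rw [integral_const_mul]
  simp only [hterm, mul_pow, sq_abs] at h
  rw [← Finset.sum_mul, Real.sqrt_mul (by positivity), Real.sqrt_sq hI0] at h
  simp only [_root_.smul_apply, ContinuousLinearMap.id_apply] at h
  have hq := quarter_volume_rpow_le_integral_gauge hn hC.2.1 hvol hK
  have h' : euclNorm t * (1 / 4 * (volume K).toReal ^ (-(1 : ℝ) / n)) ≤ √2 * c *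
      ∫ x, hK.seminorm (∑ j, t j • x j) ∂Measure.pi (fun _ : Fin s => volume.restrict C) :=
    (mul_le_mul_of_nonneg_left hq (Real.sqrt_nonneg _)).trans h
  calc _ = euclNorm t * (1 / 4 * (volume K).toReal ^ (-(1 : ℝ) / n)) / (√2 * c) := by
        field_simp
    _ ≤ _ := by
        rw [div_le_iff₀ (by positivity)]
        linarith

theorem upper_bound_sum_smul_seminorm {n N : ℕ} {K : Set (EuclideanSpace ℝ (Fin n))} (hn : n ≠ 0)
    (hK : IsSymmConvexBody K) {c : ℝ} (hc : 0 < c) (hcot : CotypeTwoIneq K c) {b : ℝ} (hb : 0 ≤ b)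
    (y : Fin N → EuclideanSpace ℝ (Fin n)) (hy : ∀ ξ, ∑ i, ⟪y i, ξ⟫ ^ 2 = b ^ 2 * ‖ξ‖ ^ 2) :
    (∫ x, |x| ∂ProbabilityTheory.gaussianReal 0 1) * √(∑ i, hK.seminorm (y i) ^ 2)
      ≤ √2 * c * (b * (sphereM K * √n)) := by
  set κ := ∫ x, |x| ∂ProbabilityTheory.gaussianReal 0 1 with hκ
  have hκ0 : 0 < κ := integral_abs_gaussianReal_pos
  have hneg : MeasurePreserving (fun v : ℝ => -v) (ProbabilityTheory.gaussianReal 0 1)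
      (ProbabilityTheory.gaussianReal 0 1) :=
    ⟨measurable_neg, by simpa using ProbabilityTheory.gaussianReal_map_neg (μ := 0) (v := 1)⟩
  have happ (i : Fin N) (v : ℝ) :
      hK.seminorm (((ContinuousLinearMap.id ℝ ℝ).smulRight (y i)) v)
        = |v| * hK.seminorm (y i) := by
    simp [map_smul_eq_mul]
  have h := sqrt_sum_sq_integral_le hK.seminorm hK.continuous_seminorm
    (k := N) (hcot.sqrt_sum_sq_le hK hc) (ProbabilityTheory.gaussianReal 0 1) hneg
    (fun i => (ContinuousLinearMap.id ℝ ℝ).smulRight (y i)) fun i => by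
      simp only [happ]
      exact ProbabilityTheory.IsGaussian.integrable_id.abs.mul_const _
  simp only [happ, integral_mul_const, mul_pow] at h
  rw [← Finset.mul_sum, Real.sqrt_mul (by positivity), Real.sqrt_sq hκ0.le] at h
  refine h.trans ?_
  gcongr
  have hn' : Nontrivial (EuclideanSpace ℝ (Fin n)) := by
    rw [← Module.finrank_pos_iff (R := ℝ), finrank_euclideanSpace_fin]
    exact Nat.pos_of_ne_zero hn
  have hp := hK.continuous_seminorm
  calc ∫ g : Fin N → ℝ, hK.seminorm (∑ i, (ContinuousLinearMap.id ℝ ℝ).smulRight (y i) (g i))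
        ∂Measure.pi (fun _ => ProbabilityTheory.gaussianReal 0 1)
      = ∫ z, hK.seminorm z ∂(Measure.pi fun _ : Fin N =>
          ProbabilityTheory.gaussianReal 0 1).map (fun g => ∑ i, g i • y i) := by
        rw [integral_map (Continuous.aemeasurable (by fun_prop)) hp.aestronglyMeasurable]
        rfl
    _ = b * ∫ z, hK.seminorm z
          ∂ProbabilityTheory.stdGaussian (EuclideanSpace ℝ (Fin n)) := by
        rw [map_sum_smul_pi_gaussianReal y b hy,
          integral_map (Continuous.aemeasurable (by fun_prop)) hp.aestronglyMeasurable]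
        simp only [map_smul_eq_mul, Real.norm_of_nonneg hb]
        rw [integral_const_mul]
    _ ≤ b * (sphereM K * √n) := by
        gcongr
        rw [integral_stdGaussian_eq_average_mul _ fun r hr x => by
          rw [map_smul_eq_mul, Real.norm_of_nonneg hr.le]]
        refine mul_le_mul_of_nonneg_left (integral_norm_stdGaussian_le n) ?_
        rw [average_eq]
        exact smul_nonneg (by positivity) (integral_nonneg fun ξ => apply_nonneg _ _)

theorem upper_bound_integral_gauge {n s : ℕ} {C K : Set (EuclideanSpace ℝ (Fin n))}
    (hn : n ≠ 0) (hC : IsSymmConvexBody C) {L : ℝ} (hiso : IsIsotropic C L)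
    (hK : IsSymmConvexBody K) {c : ℝ} (hc : 0 < c) (hcot : CotypeTwoIneq K c) (t : Fin s → ℝ) :
    ∫ x, hK.seminorm (∑ j, t j • x j) ∂Measure.pi (fun _ : Fin s => volume.restrict C)
      ≤ √2 / (∫ x, |x| ∂ProbabilityTheory.gaussianReal 0 1) * L * c * √n * sphereM K
        * euclNorm t := by
  have : IsProbabilityMeasure (volume.restrict C) := ⟨by simpa using hiso.1⟩
  set P := Measure.pi fun _ : Fin s => volume.restrict C with hP
  have hPr : P = (volume : Measure (Fin s → EuclideanSpace ℝ (Fin n))).restrict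
      (Set.univ.pi fun _ => C) := by
    rw [hP, volume_pi, Measure.restrict_pi_pi]
  have hA : IsCompact (Set.univ.pi fun _ : Fin s => C) := isCompact_univ_pi fun _ => hC.2.1
  have hAP : ∀ᵐ x ∂P, x ∈ Set.univ.pi fun _ : Fin s => C := by
    rw [hPr]
    exact ae_restrict_mem hA.measurableSet
  let S : (Fin s → EuclideanSpace ℝ (Fin n)) → EuclideanSpace ℝ (Fin n) := fun x => ∑ j, t j • x j
  have hS : Continuous S := by fun_prop
  have hSP (ξ : EuclideanSpace ℝ (Fin n)) :
      ∫ x, ⟪S x, ξ⟫ ^ 2 ∂P = (L * euclNorm t) ^ 2 * ‖ξ‖ ^ 2 :=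
    hiso.integral_inner_sum_sq hC.2.1 t ξ
  change ∫ x, hK.seminorm (S x) ∂P ≤ _
  clear_value S
  let Φ : (Fin s → EuclideanSpace ℝ (Fin n)) →
      (EuclideanSpace ℝ (Fin n) →L[ℝ] EuclideanSpace ℝ (Fin n)) × ℝ :=
    fun x => (InnerProductSpace.rankOne ℝ (S x) (S x), hK.seminorm (S x))
  have hp := hK.continuous_seminorm
  have hΦ : Continuous Φ :=
    (((InnerProductSpace.rankOne ℝ).continuous.comp hS).clm_apply hS).prodMk (hp.comp hS)
  have hΦint : Integrable Φ P := by
    rw [hPr]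
    exact hΦ.continuousOn.integrableOn_compact hA
  obtain ⟨N, w, x, hw, hw1, hsum⟩ := exists_sum_smul_eq_integral hA hAP hΦ hΦint
  have hnorm : ∑ i, w i * hK.seminorm (S (x i)) = ∫ x, hK.seminorm (S x) ∂P := by
    have := congrArg (ContinuousLinearMap.snd ℝ _ _) hsum
    rw [← ContinuousLinearMap.integral_comp_comm _ hΦint, map_sum] at this
    simpa [Φ] using this
  have hinner (ξ : EuclideanSpace ℝ (Fin n)) :
      ∑ i, w i * ⟪S (x i), ξ⟫ ^ 2 = (L * euclNorm t) ^ 2 * ‖ξ‖ ^ 2 := by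
    have := congrArg ((innerSL ℝ ξ) ∘L (ContinuousLinearMap.apply ℝ _ ξ) ∘L
      (ContinuousLinearMap.fst ℝ (EuclideanSpace ℝ (Fin n) →L[ℝ] EuclideanSpace ℝ (Fin n)) ℝ)) hsum
    rw [← ContinuousLinearMap.integral_comp_comm _ hΦint, map_sum] at this
    rw [← hSP]
    simpa [Φ, real_inner_smul_right, real_inner_comm ξ, ← sq] using this
  have hL : 0 < L := hiso.2.2.1
  have hb : 0 ≤ L * euclNorm t := mul_nonneg hL.le (Real.sqrt_nonneg _)
  have h := upper_bound_sum_smul_seminorm hn hK hc hcot hb (fun i => √(w i) • S (x i)) fun ξ => by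
    rw [← hinner]
    refine Finset.sum_congr rfl fun i _ => ?_
    rw [real_inner_smul_left, mul_pow, Real.sq_sqrt (hw i)]
  have hjensen : ∫ x, hK.seminorm (S x) ∂P ≤ √(∑ i, hK.seminorm (√(w i) • S (x i)) ^ 2) := by
    rw [← hnorm]
    refine Real.le_sqrt_of_sq_le ?_
    calc (∑ i, w i * hK.seminorm (S (x i))) ^ 2
        ≤ ∑ i, w i * hK.seminorm (S (x i)) ^ 2 :=
          Real.pow_arith_mean_le_arith_mean_pow _ _ _ (fun i _ => hw i) hw1
            (fun i _ => apply_nonneg _ _) 2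
      _ = _ := by
        refine Finset.sum_congr rfl fun i _ => ?_
        rw [map_smul_eq_mul, mul_pow, Real.norm_eq_abs, sq_abs, Real.sq_sqrt (hw i)]
  have hκ0 := integral_abs_gaussianReal_pos
  have h2 := (mul_le_mul_of_nonneg_left hjensen hκ0.le).trans h
  rw [mul_comm, ← le_div_iff₀ hκ0] at h2
  refine h2.trans_eq ?_
  ring

/-- there are absolute constants `c₁, c₂ > 0` such that for any isotropic
centrally symmetric convex body `C` in `ℝⁿ` and any centrally symmetric convex body `K`
with cotype-2 constant `C₂(X_K)`, for every `s ≥ 1` and `t ∈ ℝˢ`,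
`(c₁/C₂(X_K)) vol(K)^{-1/n} ‖t‖₂ ≤ ∫_C⋯∫_C ‖∑ t_j x_j‖_K ≤ c₂ L_C C₂(X_K) √n M(K) ‖t‖₂`. -/
theorem stmt11 :
    ∃ c₁ c₂ : ℝ, 0 < c₁ ∧ 0 < c₂ ∧
      ∀ (n s : ℕ) (_hs : 1 ≤ s)
        (C : Set (EuclideanSpace ℝ (Fin n))) (_hC : IsSymmConvexBody C)
        (L : ℝ) (_hCiso : IsIsotropic C L)
        (K : Set (EuclideanSpace ℝ (Fin n))) (_hK : IsSymmConvexBody K)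
        (C₂ : ℝ) (_hC₂ : IsLeast {c : ℝ | 0 < c ∧ CotypeTwoIneq K c} C₂)
        (t : Fin s → ℝ),
        c₁ / C₂ * (volume K).toReal ^ (-(1 : ℝ) / n) * euclNorm t
            ≤ (∫ x in Set.univ.pi fun _ : Fin s => C, gauge K (∑ j, t j • x j)) ∧
          (∫ x in Set.univ.pi fun _ : Fin s => C, gauge K (∑ j, t j • x j))
            ≤ c₂ * L * C₂ * Real.sqrt n * sphereM K * euclNorm t := by
  refine ⟨1 / (4 * √2), √2 / ∫ x, |x| ∂ProbabilityTheory.gaussianReal 0 1, by positivity,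
    div_pos (by positivity) integral_abs_gaussianReal_pos, ?_⟩
  intro n s _ C hC L hiso K hK C₂ hC₂ t
  have hn := CotypeTwoIneq.dim_ne_zero_of_isLeast hC₂
  have hP : volume.restrict (Set.univ.pi fun _ : Fin s => C)
      = Measure.pi fun _ => volume.restrict C := by
    rw [volume_pi, Measure.restrict_pi_pi]
  rw [hP]
  exact ⟨lower_bound_integral_gauge hn hC hiso.1 hK hC₂.1.1 hC₂.1.2 t,
    upper_bound_integral_gauge hn hC hiso hK hC₂.1.1 hC₂.1.2 t⟩
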